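/- arXiv:2006.16435 — 3 statements merged into one kernel-verified Lean document; each statement's English description precedes it below -/
import Mathlib

section
/- Let (φ, ξ, η) be an abelian almost contact structure on a finite-dimensional real Lie algebra 𝔤 with ξ in the center of 𝔤, and let 𝔥 := ker η. For X, Y ∈ 𝔥 define [X,Y]_𝔥 := [X,Y] − η([X,Y])·ξ and σ(X,Y) := η([X,Y]). Then: (a) [X,Y]_𝔥 ∈ 𝔥, and the bracket [·,·]_𝔥 is skew-symmetric and satisfies the Jacobi identity on 𝔥; (b) σ is a 2-cocycle with respect to [·,·]_𝔥, i.e. σ is alternating bilinear and σ([X,Y]_𝔥, Z) + σ([Y,Z]_𝔥, X) + σ([Z,X]_𝔥, Y) = 0 for all X, Y, Z ∈ 𝔥; (c) J := φ restricted to 𝔥 maps 𝔥 to 𝔥, satisfies J(J(X)) = −X, [J(X), J(Y)]_𝔥 = [X,Y]_𝔥, and σ(J(X), J(Y)) = σ(X,Y) for all X, Y ∈ 𝔥. -/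
variable {L : Type*} [LieRing L] [LieAlgebra ℝ L]

/-- The induced bracket `[X,Y]_𝔥 := [X,Y] − η([X,Y])·ξ` on `𝔥 = ker η`. -/
def brH (η : L →ₗ[ℝ] ℝ) (ξ : L) (X Y : L) : L := ⁅X, Y⁆ - η ⁅X, Y⁆ • ξ

/-- The induced 2-cocycle `σ(X,Y) := η([X,Y])`. -/
def sigH (η : L →ₗ[ℝ] ℝ) (X Y : L) : ℝ := η ⁅X, Y⁆

section AlmostContact

variable (φ : L →ₗ[ℝ] L) (ξ : L) (η : L →ₗ[ℝ] ℝ)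

/-- The endomorphism of an almost contact structure kills the Reeb vector. -/
lemma almostContact_phi_xi (hφ : ∀ x : L, φ (φ x) = -x + η x • ξ) (hη : η ξ = 1) :
    φ ξ = 0 := by
  have h2 : φ (φ ξ) = 0 := by simp [hφ, hη]
  have hc : φ ξ = η (φ ξ) • ξ := by
    have h := hφ (φ ξ)
    rw [h2, map_zero] at h
    exact (neg_add_eq_zero.mp h.symm)
  have h0 : η (φ ξ) • φ ξ = 0 := by rw [← map_smul, ← hc, h2]
  have hz : η (φ ξ) = 0 := by simpa using congrArg η h0
  rw [hc, hz, zero_smul]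

/-- The endomorphism of an almost contact structure takes values in `ker η`. -/
lemma almostContact_eta_phi (hφ : ∀ x : L, φ (φ x) = -x + η x • ξ) (hη : η ξ = 1) (x : L) :
    η (φ x) = 0 := by
  have h := hφ (φ x)
  rw [hφ x, map_add, map_neg, map_smul, almostContact_phi_xi φ ξ η hφ hη, smul_zero] at h
  simpa [hη] using congrArg η (add_left_cancel h).symm

/-- Bracketing with a central correction: the `ξ`-component of the induced bracket drops out. -/
lemma lie_brH_left (hcentral : ∀ x : L, ⁅ξ, x⁆ = 0) (X Y Z : L) :
    ⁅brH η ξ X Y, Z⁆ = ⁅⁅X, Y⁆, Z⁆ := by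
  simp [brH, hcentral]

/-- The Jacobi identity with all brackets nested on the left. -/
lemma lie_lie_cyclic {M : Type*} [LieRing M] (X Y Z : M) : ⁅⁅X, Y⁆, Z⁆ + ⁅⁅Y, Z⁆, X⁆ + ⁅⁅Z, X⁆, Y⁆ = 0 := by
  have h := lie_jacobi X Y Z
  rw [← lie_skew X, ← lie_skew Y ⁅Z, X⁆, ← lie_skew Z ⁅X, Y⁆] at h
  rw [← neg_eq_zero, ← h]
  abel

/-- The cocycle identity for `σ`. -/
lemma sigH_brH_cyclic (hcentral : ∀ x : L, ⁅ξ, x⁆ = 0) (X Y Z : L) :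
    sigH η (brH η ξ X Y) Z + sigH η (brH η ξ Y Z) X + sigH η (brH η ξ Z X) Y = 0 := by
  simp only [sigH, lie_brH_left ξ η hcentral, ← map_add, lie_lie_cyclic, map_zero]

/-- The Jacobi identity for the induced bracket. -/
lemma brH_jacobi (hcentral : ∀ x : L, ⁅ξ, x⁆ = 0) (X Y Z : L) :
    brH η ξ (brH η ξ X Y) Z + brH η ξ (brH η ξ Y Z) X + brH η ξ (brH η ξ Z X) Y = 0 := by
  have h (A B C : L) : brH η ξ (brH η ξ A B) C = ⁅⁅A, B⁆, C⁆ - η ⁅⁅A, B⁆, C⁆ • ξ := by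
    rw [brH, lie_brH_left ξ η hcentral]
  rw [h, h, h, sub_add_sub_comm, sub_add_sub_comm, ← add_smul, ← add_smul, ← map_add, ← map_add,
    lie_lie_cyclic, map_zero, zero_smul, sub_zero]

end AlmostContact

/-- for an abelian almost contact structure with central `ξ`,
`𝔥 = ker η` inherits a Lie algebra structure `[·,·]_𝔥`, `σ` is a `J`-invariant 2-cocycle
and `J = φ|_𝔥` is an abelian complex structure on `(𝔥, [·,·]_𝔥)`. -/
theorem central_extension_structure
    [FiniteDimensional ℝ L]
    (φ : L →ₗ[ℝ] L) (ξ : L) (η : L →ₗ[ℝ] ℝ)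
    (hφ : ∀ x : L, φ (φ x) = -x + η x • ξ) (hη : η ξ = 1)
    (hab₁ : ∀ x : L, ⁅ξ, φ x⁆ = φ ⁅ξ, x⁆)
    (hab₂ : ∀ X Y : L, η X = 0 → η Y = 0 → ⁅φ X, φ Y⁆ = ⁅X, Y⁆)
    (hcentral : ∀ x : L, ⁅ξ, x⁆ = 0) :
    -- (a) the bracket `[·,·]_𝔥` maps `𝔥 × 𝔥` to `𝔥`, is skew-symmetric and satisfies Jacobi
    ((∀ X Y : L, η X = 0 → η Y = 0 → η (brH η ξ X Y) = 0) ∧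
      (∀ X Y : L, η X = 0 → η Y = 0 → brH η ξ X Y = -brH η ξ Y X) ∧
      (∀ X Y Z : L, η X = 0 → η Y = 0 → η Z = 0 →
        brH η ξ (brH η ξ X Y) Z + brH η ξ (brH η ξ Y Z) X + brH η ξ (brH η ξ Z X) Y = 0))
    ∧
    -- (b) `σ` is an alternating 2-cocycle for `[·,·]_𝔥`
    ((∀ X : L, sigH η X X = 0) ∧
      (∀ X Y : L, sigH η X Y = -sigH η Y X) ∧
      (∀ X Y Z : L, η X = 0 → η Y = 0 → η Z = 0 →
        sigH η (brH η ξ X Y) Z + sigH η (brH η ξ Y Z) X + sigH η (brH η ξ Z X) Y = 0))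
    ∧
    -- (c) `J = φ|_𝔥` is an abelian complex structure and `σ` is `J`-invariant
    ((∀ X : L, η X = 0 → η (φ X) = 0) ∧
      (∀ X : L, η X = 0 → φ (φ X) = -X) ∧
      (∀ X Y : L, η X = 0 → η Y = 0 → brH η ξ (φ X) (φ Y) = brH η ξ X Y) ∧
      (∀ X Y : L, η X = 0 → η Y = 0 → sigH η (φ X) (φ Y) = sigH η X Y)) := by
  have hηφ := almostContact_eta_phi φ ξ η hφ hη
  refine ⟨⟨fun X Y _ _ => by simp [brH, hη], fun X Y _ _ => ?_,
      fun X Y Z _ _ _ => brH_jacobi ξ η hcentral X Y Z⟩,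
    ⟨fun X => by simp [sigH], fun X Y => ?_,
      fun X Y Z _ _ _ => sigH_brH_cyclic ξ η hcentral X Y Z⟩,
    fun X _ => hηφ X, fun X hX => by simp [hφ, hX],
    fun X Y hX hY => by rw [brH, brH, hab₂ X Y hX hY],
    fun X Y hX hY => by rw [sigH, sigH, hab₂ X Y hX hY]⟩
  · rw [brH, brH, ← lie_skew X Y, map_neg, neg_smul]
    abel
  · rw [sigH, sigH, ← lie_skew X Y, map_neg]
end

section
/- Let (φ_i, ξ_i, η_i), i = 1,2,3, be an abelian almost 3-contact structure on a finite-dimensional real Lie algebra 𝔤 and set 𝒵 := φ_1([ξ_2, ξ_3]). Then the vertical subspace 𝔳 = span{ξ_1, ξ_2, ξ_3} is a Lie subalgebra of 𝔤 if and only if 𝒵 = 0. In this case there is δ ∈ ℝ such that [ξ_1, ξ_2] = 2δ·ξ_3, [ξ_2, ξ_3] = 2δ·ξ_1, and [ξ_3, ξ_1] = 2δ·ξ_2; in particular 𝔳 is abelian if δ = 0 and is isomorphic to 𝔰𝔬(3) if δ ≠ 0. -/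
/-- `(i,j,k)` is an even permutation of `(1,2,3)` (indexed here as `(0,1,2)`). -/
def evenPerm (i j k : Fin 3) : Prop :=
  (i, j, k) = ((0 : Fin 3), (1 : Fin 3), (2 : Fin 3)) ∨
  (i, j, k) = ((1 : Fin 3), (2 : Fin 3), (0 : Fin 3)) ∨
  (i, j, k) = ((2 : Fin 3), (0 : Fin 3), (1 : Fin 3))

/-- An abelian almost 3-contact structure on a real Lie algebra `L`: three almost
contact structures `(φ i, ξ i, η i)` satisfying the quaternionic-like compatibility
relations for every even permutation `(i,j,k)` of `(1,2,3)`, each of which is abelian. -/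
structure AbelianAC3 (L : Type*) [LieRing L] [LieAlgebra ℝ L] where
  φ : Fin 3 → (L →ₗ[ℝ] L)
  ξ : Fin 3 → L
  η : Fin 3 → (L →ₗ[ℝ] ℝ)
  acs : ∀ i, ∀ x : L, φ i (φ i x) = -x + η i x • ξ i
  unit : ∀ i, η i (ξ i) = 1
  comp_phi : ∀ i j k, evenPerm i j k → ∀ x : L, φ k x = φ i (φ j x) - η j x • ξ i
  comp_phi' : ∀ i j k, evenPerm i j k → ∀ x : L, φ k x = -φ j (φ i x) + η i x • ξ j
  comp_xi : ∀ i j k, evenPerm i j k → φ i (ξ j) = ξ k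
  comp_xi' : ∀ i j k, evenPerm i j k → φ j (ξ i) = -ξ k
  comp_eta : ∀ i j k, evenPerm i j k → ∀ x : L, η i (φ j x) = η k x
  comp_eta' : ∀ i j k, evenPerm i j k → ∀ x : L, η j (φ i x) = -η k x
  abelian_ad : ∀ i, ∀ x : L, ⁅ξ i, φ i x⁆ = φ i ⁅ξ i, x⁆
  abelian_br : ∀ i, ∀ X Y : L, η i X = 0 → η i Y = 0 → ⁅φ i X, φ i Y⁆ = ⁅X, Y⁆

namespace AbelianAC3

variable {L : Type*} [LieRing L] [LieAlgebra ℝ L]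

/-- Membership in the horizontal subspace `𝔥 = ⋂ ker (η i)`. -/
def inH (S : AbelianAC3 L) (x : L) : Prop := ∀ i, S.η i x = 0

/-- The horizontal subspace `𝔥` as a submodule. -/
def H (S : AbelianAC3 L) : Submodule ℝ L :=
  LinearMap.ker (S.η 0) ⊓ LinearMap.ker (S.η 1) ⊓ LinearMap.ker (S.η 2)

/-- The vertical subspace `𝔳 = span{ξ₁, ξ₂, ξ₃}`. -/
def V (S : AbelianAC3 L) : Submodule ℝ L :=
  Submodule.span ℝ {S.ξ 0, S.ξ 1, S.ξ 2}

/-- The endomorphism `ψ(X) = [ξ₁, φ₁ X]` (as a linear map on all of `L`). -/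
def psi (S : AbelianAC3 L) : L →ₗ[ℝ] L :=
  (LieAlgebra.ad ℝ L (S.ξ 0)) ∘ₗ (S.φ 0)

/-- The distinguished horizontal vector `𝒵 = φ₁([ξ₂, ξ₃])`. -/
def Z (S : AbelianAC3 L) : L := S.φ 0 ⁅S.ξ 1, S.ξ 2⁆

end AbelianAC3

namespace AbelianAC3

variable {L : Type*} [LieRing L] [LieAlgebra ℝ L]

theorem phi_xi_self (S : AbelianAC3 L) (i : Fin 3) : S.φ i (S.ξ i) = 0 := by
  have hsq : S.φ i (S.φ i (S.ξ i)) = 0 := by simp [S.acs, S.unit]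
  have hcube := S.acs i (S.φ i (S.ξ i))
  rw [hsq, map_zero] at hcube
  have hmul : S.φ i (S.ξ i) = S.η i (S.φ i (S.ξ i)) • S.ξ i :=
    (neg_add_eq_zero.mp hcube.symm)
  set c := S.η i (S.φ i (S.ξ i))
  have hcc : (c * c) • S.ξ i = 0 := by
    rw [mul_smul, ← hmul, ← map_smul, ← hmul, hsq]
  have hc : c * c = 0 := by simpa [S.unit] using congrArg (S.η i) hcc
  rw [hmul, mul_self_eq_zero.mp hc, zero_smul]

theorem eta_phi_self (S : AbelianAC3 L) (i : Fin 3) (x : L) : S.η i (S.φ i x) = 0 := by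
  have h := congrArg (S.φ i) (S.acs i x)
  rw [S.acs i (S.φ i x), map_add, map_neg, map_smul, S.phi_xi_self, smul_zero, add_zero,
    add_eq_left] at h
  simpa [S.unit] using congrArg (S.η i) h

theorem eta_lie_xi (S : AbelianAC3 L) (i : Fin 3) (x : L) : S.η i ⁅S.ξ i, x⁆ = 0 := by
  have hx : x = -S.φ i (S.φ i x) + S.η i x • S.ξ i := by rw [S.acs]; abel
  rw [hx, lie_add, lie_neg, lie_smul, lie_self, S.abelian_ad, smul_zero, add_zero, map_neg,
    S.eta_phi_self, neg_zero]

theorem evenPerm_rotate {i j k : Fin 3} (h : evenPerm i j k) : evenPerm j k i := by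
  simp only [evenPerm, Prod.mk.injEq] at *
  tauto

theorem eta_xi_right (S : AbelianAC3 L) {i j k : Fin 3} (h : evenPerm i j k) :
    S.η i (S.ξ j) = 0 := by
  have := S.comp_xi' k i j (evenPerm_rotate (evenPerm_rotate h))
  rw [← neg_eq_iff_eq_neg] at this
  rw [← this, map_neg, S.eta_phi_self, neg_zero]

theorem eta_xi_left (S : AbelianAC3 L) {i j k : Fin 3} (h : evenPerm i j k) :
    S.η i (S.ξ k) = 0 := by
  rw [← S.comp_xi i j k h, S.eta_phi_self]

theorem phi_lie_xi (S : AbelianAC3 L) {i j k : Fin 3} (h : evenPerm i j k) :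
    S.φ i ⁅S.ξ i, S.ξ j⁆ = -⁅S.ξ k, S.ξ i⁆ := by
  rw [← S.abelian_ad, S.comp_xi i j k h, lie_skew]

theorem phi_lie_xi' (S : AbelianAC3 L) {i j k : Fin 3} (h : evenPerm i j k) :
    S.φ j ⁅S.ξ i, S.ξ j⁆ = ⁅S.ξ j, S.ξ k⁆ := by
  rw [← lie_skew, map_neg, ← S.abelian_ad, S.comp_xi' i j k h, lie_neg, neg_neg]

theorem eta_lie_xi_right (S : AbelianAC3 L) (i j : Fin 3) : S.η j ⁅S.ξ i, S.ξ j⁆ = 0 := by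
  rw [← lie_skew, map_neg, S.eta_lie_xi, neg_zero]

theorem evenPerm_zero_one_two : evenPerm 0 1 2 := Or.inl rfl

theorem Z_eq (S : AbelianAC3 L) : S.Z = S.φ 2 ⁅S.ξ 0, S.ξ 1⁆ := by
  rw [Z, ← S.phi_lie_xi' evenPerm_zero_one_two, S.comp_phi 0 1 2 evenPerm_zero_one_two,
    S.eta_lie_xi_right, zero_smul, sub_zero]

theorem xi_mem_V (S : AbelianAC3 L) (i : Fin 3) : S.ξ i ∈ S.V := by
  apply Submodule.subset_span
  fin_cases i <;> simp

theorem mem_V_iff (S : AbelianAC3 L) {x : L} :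
    x ∈ S.V ↔ ∃ a b c : ℝ, a • S.ξ 0 + b • S.ξ 1 + c • S.ξ 2 = x := by
  simp only [V, Submodule.mem_span_insert, Submodule.mem_span_singleton]
  constructor
  · rintro ⟨a, _, ⟨b, _, ⟨c, rfl⟩, rfl⟩, rfl⟩
    exact ⟨a, b, c, add_assoc _ _ _⟩
  · rintro ⟨a, b, c, rfl⟩
    exact ⟨a, _, ⟨b, _, ⟨c, rfl⟩, rfl⟩, add_assoc _ _ _⟩

theorem eta_comb (S : AbelianAC3 L) (a b c : ℝ) :
    S.η 0 (a • S.ξ 0 + b • S.ξ 1 + c • S.ξ 2) = a ∧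
    S.η 1 (a • S.ξ 0 + b • S.ξ 1 + c • S.ξ 2) = b ∧
    S.η 2 (a • S.ξ 0 + b • S.ξ 1 + c • S.ξ 2) = c := by
  have h₀ := evenPerm_zero_one_two
  have h₁ := evenPerm_rotate h₀
  have h₂ := evenPerm_rotate h₁
  simp [S.unit, S.eta_xi_right h₀, S.eta_xi_left h₀, S.eta_xi_right h₁, S.eta_xi_left h₁,
    S.eta_xi_right h₂, S.eta_xi_left h₂]

theorem Z_eq_zero_of_lie_mem_V (S : AbelianAC3 L)
    (h : ∀ x ∈ S.V, ∀ y ∈ S.V, ⁅x, y⁆ ∈ S.V) : S.Z = 0 := by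
  obtain ⟨a, b, c, habc⟩ := S.mem_V_iff.mp (h _ (S.xi_mem_V 0) _ (S.xi_mem_V 1))
  obtain ⟨ha, hb, -⟩ := S.eta_comb a b c
  rw [habc] at ha hb
  rw [S.eta_lie_xi] at ha
  rw [S.eta_lie_xi_right] at hb
  rw [S.Z_eq, ← habc, ← ha, ← hb]
  simp [S.phi_xi_self]

theorem exists_lie_xi_of_Z_eq_zero (S : AbelianAC3 L) (h : S.Z = 0) :
    ∃ c : ℝ, ⁅S.ξ 0, S.ξ 1⁆ = c • S.ξ 2 ∧ ⁅S.ξ 1, S.ξ 2⁆ = c • S.ξ 0 ∧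
      ⁅S.ξ 2, S.ξ 0⁆ = c • S.ξ 1 := by
  have h₀ := evenPerm_zero_one_two
  have h₁ := evenPerm_rotate h₀
  have h₂ := evenPerm_rotate h₁
  have hsq := S.acs 2 ⁅S.ξ 0, S.ξ 1⁆
  rw [← S.Z_eq, h, map_zero] at hsq
  have hlie : ⁅S.ξ 0, S.ξ 1⁆ = S.η 2 ⁅S.ξ 0, S.ξ 1⁆ • S.ξ 2 := neg_add_eq_zero.mp hsq.symm
  generalize S.η 2 ⁅S.ξ 0, S.ξ 1⁆ = c at hlie
  refine ⟨c, hlie, ?_, ?_⟩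
  · rw [← S.phi_lie_xi' h₀, hlie, map_smul, S.comp_xi 1 2 0 h₁]
  · rw [← neg_eq_iff_eq_neg.mpr (S.phi_lie_xi h₀), hlie, map_smul, S.comp_xi' 2 0 1 h₂, smul_neg,
      neg_neg]

theorem lie_comb (S : AbelianAC3 L) {r : ℝ} (h₂ : ⁅S.ξ 0, S.ξ 1⁆ = r • S.ξ 2)
    (h₀ : ⁅S.ξ 1, S.ξ 2⁆ = r • S.ξ 0) (h₁ : ⁅S.ξ 2, S.ξ 0⁆ = r • S.ξ 1) (a b c a' b' c' : ℝ) :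
    ⁅a • S.ξ 0 + b • S.ξ 1 + c • S.ξ 2, a' • S.ξ 0 + b' • S.ξ 1 + c' • S.ξ 2⁆ =
      r • ((b * c' - c * b') • S.ξ 0 + (c * a' - a * c') • S.ξ 1 +
        (a * b' - b * a') • S.ξ 2) := by
  have h₂' : ⁅S.ξ 1, S.ξ 0⁆ = -(r • S.ξ 2) := by rw [← h₂, lie_skew]
  have h₀' : ⁅S.ξ 2, S.ξ 1⁆ = -(r • S.ξ 0) := by rw [← h₀, lie_skew]
  have h₁' : ⁅S.ξ 0, S.ξ 2⁆ = -(r • S.ξ 1) := by rw [← h₁, lie_skew]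
  simp only [add_lie, lie_add, smul_lie, lie_smul, lie_self, h₀, h₁, h₂, h₀', h₁', h₂']
  module

/-- The linear map `𝔰𝔬(3) → L` sending `E_i` to `r⁻¹ ξ_i`, where `E_i` is the
infinitesimal rotation about the `i`-th axis. -/
noncomputable def soToLie (S : AbelianAC3 L) (r : ℝ) :
    LieAlgebra.Orthogonal.so (Fin 3) ℝ →ₗ[ℝ] L where
  toFun M := (r⁻¹ * M.1 2 1) • S.ξ 0 + (r⁻¹ * M.1 0 2) • S.ξ 1 + (r⁻¹ * M.1 1 0) • S.ξ 2
  map_add' M N := by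
    simp only [AddMemClass.coe_add, Matrix.add_apply]
    module
  map_smul' t M := by
    simp only [SetLike.val_smul, Matrix.smul_apply, smul_eq_mul, RingHom.id_apply]
    module

theorem so_apply_eq_neg (M : LieAlgebra.Orthogonal.so (Fin 3) ℝ) (i j : Fin 3) :
    M.1 i j = -M.1 j i := by
  have h := (LieAlgebra.Orthogonal.mem_so (n := Fin 3) (R := ℝ) M.1).mp M.2
  simpa using congrFun (congrFun h j) i

theorem soToLie_lie (S : AbelianAC3 L) {r : ℝ} (hr : r ≠ 0) (h₂ : ⁅S.ξ 0, S.ξ 1⁆ = r • S.ξ 2)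
    (h₀ : ⁅S.ξ 1, S.ξ 2⁆ = r • S.ξ 0) (h₁ : ⁅S.ξ 2, S.ξ 0⁆ = r • S.ξ 1)
    (M N : LieAlgebra.Orthogonal.so (Fin 3) ℝ) :
    S.soToLie r ⁅M, N⁆ = ⁅S.soToLie r M, S.soToLie r N⁆ := by
  have diag (M : LieAlgebra.Orthogonal.so (Fin 3) ℝ) (i : Fin 3) : M.1 i i = 0 := by
    linarith [so_apply_eq_neg M i i]
  simp only [soToLie, LinearMap.coe_mk, AddHom.coe_mk, S.lie_comb h₂ h₀ h₁,
    LieSubalgebra.coe_bracket, Ring.lie_def, Matrix.sub_apply, Matrix.mul_apply,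
    Fin.sum_univ_three, smul_add, smul_smul,
    diag, so_apply_eq_neg _ 0 1, so_apply_eq_neg _ 1 2, so_apply_eq_neg _ 2 0]
  match_scalars <;> field_simp <;> ring

theorem soToLie_injective (S : AbelianAC3 L) {r : ℝ} (hr : r ≠ 0) :
    Function.Injective (S.soToLie r) := by
  rw [← LinearMap.ker_eq_bot, LinearMap.ker_eq_bot']
  intro M hM
  obtain ⟨e₀, e₁, e₂⟩ := S.eta_comb (r⁻¹ * M.1 2 1) (r⁻¹ * M.1 0 2) (r⁻¹ * M.1 1 0)
  change _ + _ + _ = (0 : L) at hM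
  rw [hM, map_zero, eq_comm] at e₀ e₁ e₂
  simp only [mul_eq_zero, inv_eq_zero, hr, false_or] at e₀ e₁ e₂
  ext i j
  have hneg := so_apply_eq_neg M
  fin_cases i <;> fin_cases j <;> simp <;>
    linarith [hneg 0 0, hneg 1 1, hneg 2 2, hneg 0 1, hneg 1 2, hneg 2 0]

theorem range_soToLie (S : AbelianAC3 L) {r : ℝ} (hr : r ≠ 0) :
    LinearMap.range (S.soToLie r) = S.V := by
  ext x
  rw [S.mem_V_iff, LinearMap.mem_range]
  constructor
  · rintro ⟨M, rfl⟩
    exact ⟨_, _, _, rfl⟩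
  · rintro ⟨a, b, c, rfl⟩
    refine ⟨⟨r • !![0, -c, b; c, 0, -a; -b, a, 0], ?_⟩, ?_⟩
    · rw [LieAlgebra.Orthogonal.mem_so]
      ext i j
      fin_cases i <;> fin_cases j <;> simp
    · simp [soToLie, hr]

theorem nonempty_lieSpan_equiv_so (S : AbelianAC3 L) {r : ℝ} (hr : r ≠ 0)
    (h₂ : ⁅S.ξ 0, S.ξ 1⁆ = r • S.ξ 2) (h₀ : ⁅S.ξ 1, S.ξ 2⁆ = r • S.ξ 0)
    (h₁ : ⁅S.ξ 2, S.ξ 0⁆ = r • S.ξ 1) :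
    Nonempty (LieSubalgebra.lieSpan ℝ L {S.ξ 0, S.ξ 1, S.ξ 2} ≃ₗ⁅ℝ⁆
      LieAlgebra.Orthogonal.so (Fin 3) ℝ) := by
  let f : LieAlgebra.Orthogonal.so (Fin 3) ℝ →ₗ⁅ℝ⁆ L :=
    { S.soToLie r with map_lie' := fun {M N} => S.soToLie_lie hr h₂ h₀ h₁ M N }
  have hrange : f.range.toSubmodule = S.V := S.range_soToLie hr
  have hspan : LieSubalgebra.lieSpan ℝ L {S.ξ 0, S.ξ 1, S.ξ 2} = f.range := by
    apply le_antisymm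
    · rw [LieSubalgebra.lieSpan_le]
      intro x hx
      change x ∈ f.range.toSubmodule
      rw [hrange]
      exact Submodule.subset_span hx
    · rw [← LieSubalgebra.toSubmodule_le_toSubmodule, hrange]
      exact LieSubalgebra.submodule_span_le_lieSpan
  rw [hspan]
  exact ⟨(LieEquiv.ofInjective f (S.soToLie_injective hr)).symm⟩

theorem lie_mem_V_of_Z_eq_zero (S : AbelianAC3 L) (h : S.Z = 0) {x y : L} (hx : x ∈ S.V)
    (hy : y ∈ S.V) : ⁅x, y⁆ ∈ S.V := by
  obtain ⟨r, h₂, h₀, h₁⟩ := S.exists_lie_xi_of_Z_eq_zero h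
  obtain ⟨a, b, c, rfl⟩ := S.mem_V_iff.mp hx
  obtain ⟨a', b', c', rfl⟩ := S.mem_V_iff.mp hy
  rw [S.lie_comb h₂ h₀ h₁]
  exact S.V.smul_mem r (S.mem_V_iff.mpr ⟨_, _, _, rfl⟩)

end AbelianAC3

/-- the vertical subspace `𝔳` is a subalgebra iff `𝒵 = 0`, in which case
`[ξ_i, ξ_j] = 2δ·ξ_k` for some `δ ∈ ℝ`; `𝔳` is abelian if `δ = 0` and isomorphic to
`𝔰𝔬(3)` if `δ ≠ 0`. -/
theorem AbelianAC3.vertical_subalgebra_iff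
    {L : Type*} [LieRing L] [LieAlgebra ℝ L] [FiniteDimensional ℝ L]
    (S : AbelianAC3 L) :
    ((∀ x ∈ S.V, ∀ y ∈ S.V, ⁅x, y⁆ ∈ S.V) ↔ S.Z = 0) ∧
    (S.Z = 0 → ∃ δ : ℝ,
      ⁅S.ξ 0, S.ξ 1⁆ = (2 * δ) • S.ξ 2 ∧
      ⁅S.ξ 1, S.ξ 2⁆ = (2 * δ) • S.ξ 0 ∧
      ⁅S.ξ 2, S.ξ 0⁆ = (2 * δ) • S.ξ 1 ∧
      (δ = 0 → ∀ x ∈ S.V, ∀ y ∈ S.V, ⁅x, y⁆ = (0 : L)) ∧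
      (δ ≠ 0 → Nonempty
        ((LieSubalgebra.lieSpan ℝ L {S.ξ 0, S.ξ 1, S.ξ 2}) ≃ₗ⁅ℝ⁆
          (LieAlgebra.Orthogonal.so (Fin 3) ℝ)))) := by
  refine ⟨⟨S.Z_eq_zero_of_lie_mem_V, fun h x hx y hy => S.lie_mem_V_of_Z_eq_zero h hx hy⟩,
    fun h => ?_⟩
  obtain ⟨r, h₂, h₀, h₁⟩ := S.exists_lie_xi_of_Z_eq_zero h
  obtain ⟨δ, rfl⟩ : ∃ δ, r = 2 * δ := ⟨r / 2, by ring⟩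
  refine ⟨δ, h₂, h₀, h₁, ?_, fun hδ => S.nonempty_lieSpan_equiv_so (by simpa) h₂ h₀ h₁⟩
  rintro rfl x hx y hy
  obtain ⟨a, b, c, rfl⟩ := S.mem_V_iff.mp hx
  obtain ⟨a', b', c', rfl⟩ := S.mem_V_iff.mp hy
  rw [S.lie_comb h₂ h₀ h₁, mul_zero, zero_smul]
end

section
/- Let (φ_i, ξ_i, η_i), i = 1,2,3, be an abelian almost 3-contact structure on a finite-dimensional real Lie algebra 𝔤. Then for every X ∈ 𝔥: (1) [ξ_i, [ξ_i, X]] = −ψ(ψ(X)) for all i = 1,2,3; (2) [ξ_i, [ξ_j, X]] = −[ξ_j, [ξ_i, X]] = −ψ([ξ_k, X]) for every even permutation (i,j,k) of (1,2,3). -/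
namespace AbelianAC3

variable {L : Type*} [LieRing L] [LieAlgebra ℝ L] (S : AbelianAC3 L)

theorem ξ_ne_zero (i : Fin 3) : S.ξ i ≠ 0 := fun h => by
  simpa [h] using S.unit i

theorem φ_ξ_self (i : Fin 3) : S.φ i (S.ξ i) = 0 := by
  have h₁ : S.φ i (S.φ i (S.ξ i)) = 0 := by rw [S.acs, S.unit]; simp
  have h₂ : S.φ i (S.ξ i) = S.η i (S.φ i (S.ξ i)) • S.ξ i := by
    have h := S.acs i (S.φ i (S.ξ i))
    rw [h₁, map_zero] at h
    exact (neg_add_eq_zero.mp h.symm)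
  set c := S.η i (S.φ i (S.ξ i))
  rw [h₂, map_smul, h₂, smul_smul] at h₁
  have hc : c = 0 := by simpa [S.ξ_ne_zero i] using h₁
  rw [h₂, hc, zero_smul]

theorem η_φ_self (i : Fin 3) (x : L) : S.η i (S.φ i x) = 0 := by
  have h := S.acs i (S.φ i x)
  rw [S.acs i x, map_add, map_neg, map_smul, S.φ_ξ_self, smul_zero, add_zero,
    left_eq_add] at h
  exact (smul_eq_zero.mp h).resolve_right (S.ξ_ne_zero i)

theorem η_lie_ξ_self (i : Fin 3) (x : L) : S.η i ⁅S.ξ i, x⁆ = 0 := by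
  have h := S.acs i ⁅S.ξ i, x⁆
  rw [← S.abelian_ad, ← S.abelian_ad, S.acs, lie_add, lie_neg, lie_smul, lie_self, smul_zero,
    add_zero, left_eq_add] at h
  exact (smul_eq_zero.mp h).resolve_right (S.ξ_ne_zero i)

end AbelianAC3

theorem evenPerm.rotate {i j k : Fin 3} (h : evenPerm i j k) : evenPerm j k i := by
  revert i j k
  unfold evenPerm
  decide

theorem evenPerm.exhaust {i j k : Fin 3} (h : evenPerm i j k) (l : Fin 3) :
    l = i ∨ l = j ∨ l = k := by
  revert i j k l
  unfold evenPerm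
  decide

theorem exists_evenPerm (i : Fin 3) : ∃ j k, evenPerm i j k := by
  revert i
  unfold evenPerm
  decide

namespace AbelianAC3

variable {L : Type*} [LieRing L] [LieAlgebra ℝ L] (S : AbelianAC3 L)

theorem η_ξ_next {i j k : Fin 3} (h : evenPerm i j k) : S.η j (S.ξ i) = 0 := by
  rw [← S.comp_xi j k i h.rotate, S.η_φ_self]

theorem η_ξ_prev {i j k : Fin 3} (h : evenPerm i j k) : S.η k (S.ξ i) = 0 := by
  rw [← neg_neg (S.ξ i), ← S.comp_xi' j k i h.rotate, map_neg, S.η_φ_self, neg_zero]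

variable {S} {X : L}

theorem inH.φ (hX : S.inH X) (i : Fin 3) : S.inH (S.φ i X) := by
  obtain ⟨j, k, h⟩ := exists_evenPerm i
  intro l
  rcases h.exhaust l with rfl | rfl | rfl
  · exact S.η_φ_self _ X
  · rw [S.comp_eta' _ _ _ h, hX, neg_zero]
  · rw [S.comp_eta _ _ _ h.rotate.rotate, hX]

theorem inH.lie_ξ (hX : S.inH X) (i : Fin 3) : S.inH ⁅S.ξ i, X⁆ := by
  obtain ⟨j, k, h⟩ := exists_evenPerm i
  intro l
  rcases h.exhaust l with rfl | rfl | rfl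
  · exact S.η_lie_ξ_self _ X
  · rw [← S.abelian_br k _ _ (S.η_ξ_prev h) (hX k), S.comp_xi k i _ h.rotate.rotate,
      S.η_lie_ξ_self]
  · rw [← S.abelian_br j _ _ (S.η_ξ_next h) (hX j), S.comp_xi' i j _ h, neg_lie, map_neg,
      S.η_lie_ξ_self, neg_zero]

theorem inH.psi (hX : S.inH X) : S.inH (S.psi X) :=
  (hX.φ 0).lie_ξ 0

theorem inH.φ_φ_self (hX : S.inH X) (i : Fin 3) : S.φ i (S.φ i X) = -X := by
  rw [S.acs, hX, zero_smul, add_zero]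

theorem inH.φ_φ (hX : S.inH X) {i j k : Fin 3} (h : evenPerm i j k) :
    S.φ i (S.φ j X) = S.φ k X := by
  rw [S.comp_phi i j k h, hX, zero_smul, sub_zero]

theorem inH.φ_φ' (hX : S.inH X) {i j k : Fin 3} (h : evenPerm i j k) :
    S.φ j (S.φ i X) = -S.φ k X := by
  rw [S.comp_phi' i j k h, hX, zero_smul, add_zero, neg_neg]

theorem inH.lie_ξ_φ_next (hX : S.inH X) {i j k : Fin 3} (h : evenPerm i j k) :
    ⁅S.ξ j, S.φ j X⁆ = ⁅S.ξ i, S.φ i X⁆ := by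
  rw [← S.abelian_br k _ _ (S.η_ξ_prev h) (hX.φ i k), S.comp_xi k i j h.rotate.rotate,
    hX.φ_φ h.rotate.rotate]

theorem inH.lie_ξ_φ (hX : S.inH X) (i : Fin 3) : ⁅S.ξ i, S.φ i X⁆ = S.psi X := by
  have h : evenPerm 0 1 2 := .inl rfl
  rcases h.exhaust i with rfl | rfl | rfl
  · rfl
  · exact hX.lie_ξ_φ_next h
  · exact (hX.lie_ξ_φ_next h.rotate).trans (hX.lie_ξ_φ_next h)

theorem inH.lie_ξ_eq_neg_φ_psi (hX : S.inH X) (i : Fin 3) :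
    ⁅S.ξ i, X⁆ = -S.φ i (S.psi X) := by
  rw [← hX.lie_ξ_φ i, S.abelian_ad, (hX.lie_ξ i).φ_φ_self, neg_neg]

theorem inH.psi_φ (hX : S.inH X) (i : Fin 3) : S.psi (S.φ i X) = S.φ i (S.psi X) := by
  rw [← (hX.φ i).lie_ξ_φ i, ← hX.lie_ξ_φ i, S.abelian_ad]

theorem inH.lie_ξ_lie_ξ (hX : S.inH X) (i j : Fin 3) :
    ⁅S.ξ i, ⁅S.ξ j, X⁆⁆ = S.φ i (S.φ j (S.psi (S.psi X))) := by
  rw [(hX.lie_ξ j).lie_ξ_eq_neg_φ_psi i, hX.lie_ξ_eq_neg_φ_psi j, map_neg, map_neg, neg_neg,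
    hX.psi.psi_φ]

end AbelianAC3

/-- iterated brackets with the Reeb vectors, for `X ∈ 𝔥`:
`[ξ_i,[ξ_i,X]] = −ψ²(X)` and `[ξ_i,[ξ_j,X]] = −[ξ_j,[ξ_i,X]] = −ψ([ξ_k,X])`. -/
theorem AbelianAC3.iterated_brackets
    {L : Type*} [LieRing L] [LieAlgebra ℝ L] [FiniteDimensional ℝ L]
    (S : AbelianAC3 L) :
    ∀ X : L, S.inH X →
      ((∀ i, ⁅S.ξ i, ⁅S.ξ i, X⁆⁆ = -S.psi (S.psi X)) ∧
        (∀ i j k, evenPerm i j k →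
          ⁅S.ξ i, ⁅S.ξ j, X⁆⁆ = -⁅S.ξ j, ⁅S.ξ i, X⁆⁆ ∧
          ⁅S.ξ i, ⁅S.ξ j, X⁆⁆ = -S.psi ⁅S.ξ k, X⁆)) := by
  intro X hX
  refine ⟨fun i => ?_, fun i j k h => ⟨?_, ?_⟩⟩
  · rw [hX.lie_ξ_lie_ξ, hX.psi.psi.φ_φ_self]
  · rw [hX.lie_ξ_lie_ξ, hX.lie_ξ_lie_ξ, hX.psi.psi.φ_φ h, hX.psi.psi.φ_φ' h, neg_neg]
  · rw [hX.lie_ξ_lie_ξ, hX.psi.psi.φ_φ h, hX.lie_ξ_eq_neg_φ_psi, map_neg, neg_neg,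
      hX.psi.psi_φ]
end
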